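/- Let (S, wt) be a decomposable full passport with N = |S|. Then (N−1)! = Σ_{𝔭 ∈ 𝔓} (|𝔭|−1)! · ∏_{i=1}^{|𝔭|} |P_+(S_i, wt)|, where the sum ranges over all partitions 𝔭 = {S_1,…,S_{|𝔭|}} of S into nonempty zero-sum blocks. -/

import Mathlib

open Finset

/-- Cumulative sums of a permutation (linear ordering) of a finite subset `B`
with respect to the weight `wt`: `cumSumOn wt B P i = H_i`. -/
noncomputable def cumSumOn {α : Type*} (wt : α → ℝ) (B : Finset α)
    (P : Fin B.card ≃ {x // x ∈ B}) (i : ℕ) : ℝ :=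
  ∑ j ∈ Finset.univ.filter (fun j : Fin B.card => (j : ℕ) < i), wt (P j : α)

/-- A positive permutation of `B`: all proper cumulative sums are positive. -/
def PosPermOn {α : Type*} (wt : α → ℝ) (B : Finset α)
    (P : Fin B.card ≃ {x // x ∈ B}) : Prop :=
  ∀ i, 1 ≤ i → i ≤ B.card - 1 → 0 < cumSumOn wt B P i

/-- A tree permutation of `B`: (1) `H_i ≠ 0` for `1 ≤ i ≤ |B|-1`;
(2) whenever `H_{k-1} = H_l > 0` (`1 ≤ k < l ≤ |B|`), `min{H_k,…,H_{l-1}} < H_l`;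
(3) whenever `H_{k-1} = H_l < 0` (`1 ≤ k < l ≤ |B|`), `max{H_k,…,H_{l-1}} > H_l`. -/
def TreePermOn {α : Type*} (wt : α → ℝ) (B : Finset α)
    (P : Fin B.card ≃ {x // x ∈ B}) : Prop :=
  (∀ i, 1 ≤ i → i ≤ B.card - 1 → cumSumOn wt B P i ≠ 0) ∧
  (∀ k l, 1 ≤ k → k < l → l ≤ B.card →
    cumSumOn wt B P (k - 1) = cumSumOn wt B P l → 0 < cumSumOn wt B P l →
    ∃ t, k ≤ t ∧ t < l ∧ cumSumOn wt B P t < cumSumOn wt B P l) ∧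
  (∀ k l, 1 ≤ k → k < l → l ≤ B.card →
    cumSumOn wt B P (k - 1) = cumSumOn wt B P l → cumSumOn wt B P l < 0 →
    ∃ t, k ≤ t ∧ t < l ∧ cumSumOn wt B P l < cumSumOn wt B P t)

/-- `|P_+(B, wt)|`: the number of positive permutations of `B`. -/
noncomputable def numPos {α : Type*} (wt : α → ℝ) (B : Finset α) : ℕ :=
  Nat.card {P : Fin B.card ≃ {x // x ∈ B} // PosPermOn wt B P}

/-- `|PT_+(B, wt)|`: the number of positive tree permutations of `B`. -/
noncomputable def numPosTree {α : Type*} (wt : α → ℝ) (B : Finset α) : ℕ :=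
  Nat.card {P : Fin B.card ≃ {x // x ∈ B} // PosPermOn wt B P ∧ TreePermOn wt B P}

/-- `𝔭` is a partition of `S'` into nonempty zero-sum blocks. -/
def IsPart {α : Type*} (wt : α → ℝ) (S' : Finset α) (𝔭 : Finset (Finset α)) : Prop :=
  (∀ B ∈ 𝔭, B.Nonempty) ∧ (∀ B ∈ 𝔭, B ⊆ S') ∧
  (∀ a ∈ S', ∃! B, B ∈ 𝔭 ∧ a ∈ B) ∧ (∀ B ∈ 𝔭, ∑ s ∈ B, wt s = 0)

/-- `X(𝔭) = ∏_{B ∈ 𝔭} (|B| - 1)!`. -/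
def Xval {α : Type*} (𝔭 : Finset (Finset α)) : ℕ :=
  ∏ B ∈ 𝔭, Nat.factorial (B.card - 1)

/-- The linear orderings of a finite set, as duplicate-free lists. -/
noncomputable def orderings {α : Type*} (B : Finset α) : Finset (List α) :=
  ⟨Multiset.lists B.val, Multiset.lists_nodup_finset B⟩

/-- All proper nonempty prefixes of `l` have positive weight. -/
def PosList {α : Type*} (wt : α → ℝ) (l : List α) : Prop :=
  ∀ u v, l = u ++ v → u ≠ [] → v ≠ [] → 0 < (u.map wt).sum

/-- All prefixes of `l` have nonnegative weight. -/
def NonnegList {α : Type*} (wt : α → ℝ) (l : List α) : Prop :=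
  ∀ u v, l = u ++ v → 0 ≤ (u.map wt).sum

/-- `l` starts with a positive zero-sum list whose underlying set satisfies `p`, and the
remainder is a nonnegative list. -/
def FirstBlock {α : Type*} (wt : α → ℝ) (p : List α → Prop) (l : List α) : Prop :=
  ∃ b r, l = b ++ r ∧ b ≠ [] ∧ PosList wt b ∧ (b.map wt).sum = 0 ∧ NonnegList wt r ∧ p b

section

variable {α : Type*} {wt : α → ℝ}

lemma mem_orderings {B : Finset α} {l : List α} :
    l ∈ orderings B ↔ l.Nodup ∧ ∀ x, x ∈ l ↔ x ∈ B := by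
  have h : l ∈ orderings B ↔ B.val = (l : Multiset α) := Multiset.mem_lists_iff _ _
  rw [h]
  constructor
  · intro h
    have hn := B.nodup
    rw [h, Multiset.coe_nodup] at hn
    exact ⟨hn, fun x => by rw [← Finset.mem_val, h, Multiset.mem_coe]⟩
  · rintro ⟨hn, hx⟩
    rw [Multiset.Nodup.ext B.nodup (Multiset.coe_nodup.2 hn)]
    intro x
    simp [hx]

lemma card_orderings (B : Finset α) : (orderings B).card = B.card.factorial := by
  have h : (orderings B).card = Multiset.card (Multiset.lists B.val) := rfl
  rw [h, ← Multiset.coe_toList B.val, Multiset.lists_coe, Multiset.coe_card,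
    List.length_permutations, Multiset.length_toList, Finset.card_val]

lemma sum_map_of_mem_orderings {B : Finset α} {l : List α} (h : l ∈ orderings B) :
    (l.map wt).sum = ∑ s ∈ B, wt s := by
  classical
  rw [mem_orderings] at h
  rw [← List.sum_toFinset _ h.1]
  congr 1
  ext x
  simp [h.2]

lemma length_of_mem_orderings {B : Finset α} {l : List α} (h : l ∈ orderings B) :
    l.length = B.card := by
  classical
  rw [mem_orderings] at h
  rw [← List.toFinset_card_of_nodup h.1]
  congr 1
  ext x
  simp [h.2]

open Classical in
lemma numPos_eq_card (wt : α → ℝ) (B : Finset α) :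
    numPos wt B = ((orderings B).filter (PosList wt)).card := by
  have hsum : ∀ (P : Fin B.card ≃ {x // x ∈ B}) (i : ℕ),
      (((List.ofFn fun j => (P j : α)).take i).map wt).sum = cumSumOn wt B P i := by
    intro P i
    rw [List.map_take, List.map_ofFn, List.sum_take_ofFn]
    rfl
  have hpos : ∀ P : Fin B.card ≃ {x // x ∈ B},
      PosPermOn wt B P ↔ PosList wt (List.ofFn fun j => (P j : α)) := by
    intro P
    constructor
    · intro h u v huv hu hv
      have hlen := congrArg List.length huv
      have hu' := List.length_pos_iff.2 hu
      have hv' := List.length_pos_iff.2 hv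
      simp only [List.length_ofFn, List.length_append] at hlen
      have := h u.length hu' (by omega)
      rwa [← hsum, huv, List.take_left] at this
    · intro h i h1 h2
      rw [← hsum]
      refine h _ _ (List.take_append_drop i _).symm ?_ ?_ <;>
      · rw [← List.length_pos_iff]
        simp only [List.length_take, List.length_drop, List.length_ofFn]
        omega
  rw [numPos, Nat.card_eq_fintype_card, Fintype.card_subtype]
  refine Finset.card_bij (fun P _ => List.ofFn fun j => (P j : α)) ?_ ?_ ?_
  · intro P hP
    rw [Finset.mem_filter, mem_orderings, ← hpos]
    refine ⟨⟨List.nodup_ofFn.2 (Subtype.val_injective.comp P.injective), fun x => ?_⟩,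
      (Finset.mem_filter.1 hP).2⟩
    rw [List.mem_ofFn]
    exact ⟨by rintro ⟨j, rfl⟩; exact (P j).2, fun hx => ⟨P.symm ⟨x, hx⟩, by simp⟩⟩
  · intro P _ Q _ h
    ext j
    exact congrFun (List.ofFn_injective h) j
  · intro l hl
    rw [Finset.mem_filter] at hl
    have hlen := length_of_mem_orderings hl.1
    have hmem := mem_orderings.1 hl.1
    have hbij : Function.Bijective fun j : Fin B.card =>
        (⟨l[j], (hmem.2 _).1 (List.getElem_mem _)⟩ : {x // x ∈ B}) := by
      rw [Fintype.bijective_iff_injective_and_card]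
      refine ⟨fun i j h => ?_, by simp⟩
      exact Fin.ext ((hmem.1.getElem_inj_iff).1 (Subtype.ext_iff.1 h))
    have hl' : (List.ofFn fun j => (Equiv.ofBijective _ hbij j : α)) = l := by
      apply List.ext_getElem <;> simp [hlen]
    refine ⟨Equiv.ofBijective _ hbij, ?_, hl'⟩
    rw [Finset.mem_filter, hpos, hl']
    exact ⟨Finset.mem_univ _, hl.2⟩

lemma NonnegList.exists_firstBlock {l : List α} (hl : NonnegList wt l) (hne : l ≠ [])
    (hs : (l.map wt).sum = 0) : FirstBlock wt (fun _ => True) l := by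
  classical
  have hex : ∃ k, 1 ≤ k ∧ ((l.take k).map wt).sum = 0 :=
    ⟨l.length, List.length_pos_iff.2 hne, by simpa using hs⟩
  obtain ⟨h1, h0⟩ := Nat.find_spec hex
  have hmin := fun m hm => Nat.find_min (m := m) hex hm
  set k := Nat.find hex
  refine ⟨l.take k, l.drop k, (List.take_append_drop k l).symm, ?_, ?_, h0, ?_, trivial⟩
  · simp [hne]; omega
  · intro u v huv hu hv
    have hlt : u.length < k := by
      have := congrArg List.length huv
      have := List.length_pos_iff.2 hv
      simp at *
      omega
    have hl' : l = u ++ (v ++ l.drop k) := by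
      rw [← List.append_assoc, ← huv, List.take_append_drop]
    have h2 := hmin _ hlt
    have hu1 := List.length_pos_iff.2 hu
    have htake : l.take u.length = u := by rw [hl']; simp
    rw [htake] at h2
    exact lt_of_le_of_ne (hl _ _ hl') fun h => h2 ⟨hu1, h.symm⟩
  · intro u v huv
    have h2 := hl (l.take k ++ u) v (by
      rw [List.append_assoc, ← huv, List.take_append_drop])
    rwa [List.map_append, List.sum_append, h0, zero_add] at h2

lemma PosList.nonneg {b : List α} (hb : PosList wt b) (h0 : (b.map wt).sum = 0) :
    NonnegList wt b := by
  intro u v huv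
  by_cases hu : u = []
  · simp [hu]
  by_cases hv : v = []
  · subst hv
    simp only [List.append_nil] at huv
    rw [← huv, h0]
  exact (hb u v huv hu hv).le

lemma FirstBlock.nonneg {p : List α → Prop} {l : List α} (h : FirstBlock wt p l) :
    NonnegList wt l := by
  obtain ⟨b, r, rfl, -, hb, h0, hr, -⟩ := h
  intro u v huv
  rcases List.append_eq_append_iff.1 huv with ⟨z, rfl, hz⟩ | ⟨z, hz, -⟩
  · simpa [h0] using hr _ _ hz
  · exact hb.nonneg h0 _ _ hz

lemma firstBlock_mem_iff {a : α} {v u : List α} (ha : a ∉ v)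
    (hs : ((v ++ a :: u).map wt).sum = 0) :
    FirstBlock wt (a ∈ ·) (v ++ a :: u) ↔
      NonnegList wt (v ++ a :: u) ∧ ∀ z y, v = z ++ y → z ≠ [] → 0 < (z.map wt).sum := by
  constructor
  · intro h
    refine ⟨h.nonneg, ?_⟩
    obtain ⟨b, r, hbr, -, hb, -, -, hab⟩ := h
    rintro z y rfl hz
    rw [List.append_assoc] at hbr
    rcases List.append_eq_append_iff.1 hbr with ⟨w, rfl, -⟩ | ⟨w, rfl, -⟩
    · refine hb z w rfl hz ?_
      rintro rfl
      simp_all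
    · simp_all
  · rintro ⟨hn, hv⟩
    obtain ⟨b, r, hbr, hne, hb, h0, hr, -⟩ := hn.exists_firstBlock (by simp) hs
    refine ⟨b, r, hbr, hne, hb, h0, hr, ?_⟩
    rcases List.append_eq_append_iff.1 hbr with ⟨w, rfl, hw⟩ | ⟨w, rfl, -⟩
    · rcases List.cons_eq_append_iff.1 hw with ⟨rfl, -⟩ | ⟨w', rfl, -⟩
      · have := hv v [] (by simp) (by simpa using hne)
        simp at h0
        linarith
      · simp
    · exact absurd h0 (hv b w rfl hne).ne'

/-- Every list can be cut at the last of its prefixes of minimal weight. -/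
lemma exists_last_min_prefix (wt : α → ℝ) (t : List α) :
    ∃ u v, t = u ++ v ∧ (∀ x y, t = x ++ y → (u.map wt).sum ≤ (x.map wt).sum) ∧
      ∀ z y, v = z ++ y → z ≠ [] → 0 < (z.map wt).sum := by
  induction t using List.reverseRecOn with
  | nil => exact ⟨[], [], by simp, by simp, by simp +contextual⟩
  | append_singleton t c ih =>
    obtain ⟨u, v, rfl, h1, h2⟩ := ih
    by_cases hc : (((u ++ v) ++ [c]).map wt).sum ≤ (u.map wt).sum
    · refine ⟨u ++ v ++ [c], [], by simp, ?_, by simp +contextual⟩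
      intro x y hxy
      rcases List.eq_nil_or_concat' y with rfl | ⟨y, d, rfl⟩
      · simp only [List.append_nil] at hxy
        rw [hxy]
      · rw [← List.append_assoc] at hxy
        exact hc.trans (h1 x y (List.append_inj_left' hxy rfl))
    · push Not at hc
      refine ⟨u, v ++ [c], by simp, ?_, ?_⟩
      · intro x y hxy
        rcases List.eq_nil_or_concat' y with rfl | ⟨y, d, rfl⟩
        · simp only [List.append_nil] at hxy
          rw [← hxy]
          exact hc.le
        · rw [← List.append_assoc] at hxy
          exact h1 x y (List.append_inj_left' hxy rfl)
      · intro z y hzy hz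
        rcases List.eq_nil_or_concat' y with rfl | ⟨y, d, rfl⟩
        · simp only [List.append_nil] at hzy
          rw [← hzy]
          simp at hc ⊢
          linarith
        · rw [← List.append_assoc] at hzy
          exact h2 z y (List.append_inj_left' hzy rfl) hz

open Classical in
/-- Cutting a cyclic ordering at the last minimum before `a`, versus cutting it at `a`. -/
lemma card_filter_firstBlock_mem {S : Finset α} {a : α} (ha : a ∈ S) (hS : ∑ s ∈ S, wt s = 0) :
    ((orderings S).filter (FirstBlock wt (a ∈ ·))).card = (S.card - 1).factorial := by
  rw [← Finset.card_erase_of_mem ha, ← card_orderings]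
  have key : ∀ w ∈ (orderings S).filter (FirstBlock wt (a ∈ ·)),
      ∃ v u, w = v ++ a :: u ∧ a ∉ v ∧ NonnegList wt (v ++ a :: u) ∧
        (∀ z y, v = z ++ y → z ≠ [] → 0 < (z.map wt).sum) ∧
        w.drop (w.idxOf a + 1) ++ w.take (w.idxOf a) = u ++ v := by
    intro w hw
    rw [Finset.mem_filter] at hw
    have hs := sum_map_of_mem_orderings (wt := wt) hw.1
    have haw := ((mem_orderings.1 hw.1).2 a).2 ha
    obtain ⟨v, u, rfl, hv⟩ := List.eq_append_cons_of_mem haw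
    obtain ⟨h1, h2⟩ := (firstBlock_mem_iff hv (hs.trans hS)).1 hw.2
    refine ⟨v, u, rfl, hv, h1, h2, ?_⟩
    simp [List.idxOf_append_of_notMem hv]
  have key2 : ∀ u v : List α, a ∉ v → (v ++ a :: u ∈ orderings S ↔ u ++ v ∈ orderings (S.erase a)) := by
    intro u v hv
    simp only [mem_orderings, List.nodup_append, List.nodup_cons, List.mem_append, List.mem_cons,
      Finset.mem_erase]
    grind
  refine Finset.card_bij (fun w _ => w.drop (w.idxOf a + 1) ++ w.take (w.idxOf a)) ?_ ?_ ?_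
  · intro w hw
    obtain ⟨v, u, rfl, hv, -, -, he⟩ := key w hw
    rw [he]
    exact (key2 u v hv).1 (Finset.mem_filter.1 hw).1
  · have aux : ∀ u₁ v₁ u₂ v₂ : List α, (∀ z y, v₁ = z ++ y → z ≠ [] → 0 < (z.map wt).sum) →
        NonnegList wt (v₂ ++ a :: u₂) → ((v₂ ++ a :: u₂).map wt).sum = 0 →
        ∀ z, u₂ = u₁ ++ z → v₁ = z ++ v₂ → z = [] := by
      rintro u₁ _ _ v₂ h1 h2 h0 z rfl rfl
      by_contra hz
      have := h1 z v₂ rfl hz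
      have := h2 (v₂ ++ a :: u₁) z (by simp)
      simp only [List.map_append, List.map_cons, List.sum_append, List.sum_cons] at *
      linarith
    intro w₁ hw₁ w₂ hw₂ he
    have hs₁ := sum_map_of_mem_orderings (wt := wt) (Finset.mem_filter.1 hw₁).1
    have hs₂ := sum_map_of_mem_orderings (wt := wt) (Finset.mem_filter.1 hw₂).1
    obtain ⟨v₁, u₁, rfl, -, hn₁, hp₁, he₁⟩ := key w₁ hw₁
    obtain ⟨v₂, u₂, rfl, -, hn₂, hp₂, he₂⟩ := key w₂ hw₂
    rw [he₁, he₂] at he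
    rcases List.append_eq_append_iff.1 he with ⟨z, h1, h2⟩ | ⟨z, h1, h2⟩
    · obtain rfl := aux u₁ v₁ u₂ v₂ hp₁ hn₂ (hs₂.trans hS) z h1 h2
      rw [List.append_nil] at h1
      rw [List.nil_append] at h2
      rw [h1, h2]
    · obtain rfl := aux u₂ v₂ u₁ v₁ hp₂ hn₁ (hs₁.trans hS) z h1 h2
      rw [List.append_nil] at h1
      rw [List.nil_append] at h2
      rw [h1, h2]
  · intro t ht
    obtain ⟨u, v, rfl, h1, h2⟩ := exists_last_min_prefix wt t
    have hat : a ∉ u ++ v := fun h => by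
      have := ((mem_orderings.1 ht).2 a).1 h
      simp at this
    have hv : a ∉ v := fun h => hat (by simp [h])
    have hm := (key2 u v hv).2 ht
    have hs := (sum_map_of_mem_orderings (wt := wt) hm).trans hS
    have hn : NonnegList wt (v ++ a :: u) := by
      intro x y hxy
      rcases List.append_eq_append_iff.1 hxy with ⟨z, rfl, hz⟩ | ⟨z, hz, -⟩
      · rcases List.cons_eq_append_iff.1 hz with ⟨rfl, -⟩ | ⟨z', rfl, rfl⟩
        · by_cases hv0 : v = []
          · simp [hv0]
          · simpa using (h2 v [] (by simp) hv0).le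
        · have := h1 z' (y ++ v) (by simp)
          simp only [List.map_append, List.map_cons, List.sum_append, List.sum_cons] at this hs ⊢
          linarith
      · by_cases hx : x = []
        · simp [hx]
        · exact (h2 x z hz hx).le
    refine ⟨v ++ a :: u, ?_, ?_⟩
    · exact Finset.mem_filter.2 ⟨hm, (firstBlock_mem_iff hv hs).2 ⟨hn, h2⟩⟩
    · simp [List.idxOf_append_of_notMem hv]

open Classical in
/-- Splitting off the first block of a nonnegative list. -/
lemma card_filter_firstBlock (wt : α → ℝ) (S : Finset α) (p : Finset α → Prop) :
    ((orderings S).filter (FirstBlock wt fun b => p b.toFinset)).card =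
      ∑ B ∈ S.powerset.filter (fun B => B.Nonempty ∧ ∑ s ∈ B, wt s = 0 ∧ p B),
        numPos wt B * ((orderings (S \ B)).filter (NonnegList wt)).card := by
  simp_rw [numPos_eq_card, ← Finset.card_product]
  rw [← Finset.card_sigma]
  symm
  have htoF : ∀ {B : Finset α} {l : List α}, l ∈ orderings B → l.toFinset = B := by
    intro B l h
    ext x
    simp [(mem_orderings.1 h).2]
  refine Finset.card_bij (fun x _ => x.2.1 ++ x.2.2) ?_ ?_ ?_
  · rintro ⟨B, b, r⟩ h
    simp only [Finset.mem_sigma, Finset.mem_filter, Finset.mem_powerset, Finset.mem_product] at h ⊢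
    obtain ⟨⟨hBS, hB, h0, hp⟩, ⟨hb, hpos⟩, hr, hn⟩ := h
    refine ⟨?_, b, r, rfl, ?_, hpos, (sum_map_of_mem_orderings hb).trans h0, hn, ?_⟩
    · rw [mem_orderings] at *
      simp only [List.nodup_append, List.mem_append, Finset.mem_sdiff] at *
      grind
    · rintro rfl
      have := htoF hb
      simp at this
      simp [← this] at hB
    · simpa only [htoF hb] using hp
  · have aux : ∀ b₁ b₂ z : List α, b₁ ≠ [] → (b₁.map wt).sum = 0 →
        PosList wt b₂ → b₂ = b₁ ++ z → z = [] := by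
      intro b₁ b₂ z h1 h0 h2 h
      by_contra hz
      exact absurd h0 (h2 _ _ h h1 hz).ne'
    rintro ⟨B₁, b₁, r₁⟩ h₁ ⟨B₂, b₂, r₂⟩ h₂ he
    simp only [Finset.mem_sigma, Finset.mem_filter, Finset.mem_powerset, Finset.mem_product] at h₁ h₂ he
    obtain ⟨⟨-, hB₁, h0₁, -⟩, ⟨hb₁, hp₁⟩, -⟩ := h₁
    obtain ⟨⟨-, hB₂, h0₂, -⟩, ⟨hb₂, hp₂⟩, -⟩ := h₂
    have hs₁ := (sum_map_of_mem_orderings hb₁).trans h0₁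
    have hs₂ := (sum_map_of_mem_orderings hb₂).trans h0₂
    have hn₁ : b₁ ≠ [] := by
      rintro rfl
      simp [← htoF hb₁] at hB₁
    have hn₂ : b₂ ≠ [] := by
      rintro rfl
      simp [← htoF hb₂] at hB₂
    have hb : b₁ = b₂ := by
      rcases List.append_eq_append_iff.1 he with ⟨z, h1, -⟩ | ⟨z, h1, -⟩
      · obtain rfl := aux b₁ b₂ z hn₁ hs₁ hp₂ h1
        simp [h1]
      · obtain rfl := aux b₂ b₁ z hn₂ hs₂ hp₁ h1
        simp [h1]
    subst hb
    obtain rfl : r₁ = r₂ := by simpa using he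
    obtain rfl : B₁ = B₂ := (htoF hb₁).symm.trans (htoF hb₂)
    rfl
  · intro l hl
    rw [Finset.mem_filter] at hl
    obtain ⟨hl, b, r, rfl, hne, hpos, h0, hn, hp⟩ := hl
    have hnd := (mem_orderings.1 hl).1
    have hmem := (mem_orderings.1 hl).2
    have hb : b ∈ orderings b.toFinset :=
      mem_orderings.2 ⟨(List.nodup_append.1 hnd).1, by simp⟩
    refine ⟨⟨b.toFinset, b, r⟩, ?_, rfl⟩
    simp only [Finset.mem_sigma, Finset.mem_filter, Finset.mem_powerset, Finset.mem_product]
    refine ⟨⟨?_, ?_, ?_, hp⟩, ⟨hb, hpos⟩, ?_, hn⟩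
    · intro x hx
      rw [← hmem]
      simp_all
    · exact List.toFinset_nonempty_iff b |>.2 hne
    · rw [← sum_map_of_mem_orderings hb, h0]
    · rw [mem_orderings]
      simp only [List.nodup_append, List.mem_append, Finset.mem_sdiff, List.mem_toFinset] at *
      grind

lemma IsPart.erase [DecidableEq α] {S B : Finset α} {𝔭 : Finset (Finset α)} (h : IsPart wt S 𝔭)
    (hB : B ∈ 𝔭) : IsPart wt (S \ B) (𝔭.erase B) := by
  obtain ⟨h1, h2, h3, h4⟩ := h
  have hdisj : ∀ C ∈ 𝔭, C ≠ B → Disjoint C B := by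
    intro C hC hne
    rw [Finset.disjoint_left]
    intro x hxC hxB
    exact hne ((h3 x (h2 C hC hxC)).unique ⟨hC, hxC⟩ ⟨hB, hxB⟩)
  refine ⟨fun C hC => h1 C (Finset.mem_of_mem_erase hC), fun C hC => ?_, fun a ha => ?_,
    fun C hC => h4 C (Finset.mem_of_mem_erase hC)⟩
  · rw [Finset.mem_erase] at hC
    exact Finset.subset_sdiff.2 ⟨h2 C hC.2, hdisj C hC.2 hC.1⟩
  · rw [Finset.mem_sdiff] at ha
    obtain ⟨C, ⟨hC, haC⟩, hu⟩ := h3 a ha.1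
    refine ⟨C, ⟨Finset.mem_erase.2 ⟨?_, hC⟩, haC⟩, fun D hD =>
      hu D ⟨Finset.mem_of_mem_erase hD.1, hD.2⟩⟩
    rintro rfl
    exact ha.2 haC

lemma IsPart.notMem_of_sdiff [DecidableEq α] {S B : Finset α} {𝔮 : Finset (Finset α)}
    (h : IsPart wt (S \ B) 𝔮) (hB : B.Nonempty) : B ∉ 𝔮 := by
  intro hmem
  obtain ⟨x, hx⟩ := hB
  exact (Finset.mem_sdiff.1 (h.2.1 B hmem hx)).2 hx

lemma IsPart.insert [DecidableEq α] {S B : Finset α} {𝔮 : Finset (Finset α)}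
    (h : IsPart wt (S \ B) 𝔮) (hBS : B ⊆ S) (hB : B.Nonempty) (h0 : ∑ s ∈ B, wt s = 0) :
    IsPart wt S (insert B 𝔮) := by
  obtain ⟨h1, h2, h3, h4⟩ := h
  refine ⟨by simpa [hB] using h1, ?_, ?_, by simpa [h0] using h4⟩
  · simp only [Finset.mem_insert, forall_eq_or_imp]
    exact ⟨hBS, fun C hC => (h2 C hC).trans Finset.sdiff_subset⟩
  · intro a ha
    by_cases haB : a ∈ B
    · refine ⟨B, ⟨by simp, haB⟩, ?_⟩
      rintro C ⟨hC, haC⟩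
      rcases Finset.mem_insert.1 hC with rfl | hC
      · rfl
      · exact absurd haB (Finset.mem_sdiff.1 (h2 C hC haC)).2
    · obtain ⟨C, ⟨hC, haC⟩, hu⟩ := h3 a (by simp [ha, haB])
      refine ⟨C, ⟨by simp [hC], haC⟩, ?_⟩
      rintro D ⟨hD, haD⟩
      rcases Finset.mem_insert.1 hD with rfl | hD
      · exact absurd haD haB
      · exact hu D ⟨hD, haD⟩

open Classical in
/-- Splitting a block satisfying `p` off a zero-sum partition. -/
lemma sum_isPart_split [Fintype α] (wt : α → ℝ) (S : Finset α) (p : Finset α → Prop) :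
    ∑ 𝔭 ∈ Finset.univ.filter (IsPart wt S),
        (𝔭.filter p).card * ((𝔭.card - 1).factorial * ∏ B ∈ 𝔭, numPos wt B) =
      ∑ B ∈ S.powerset.filter (fun B => B.Nonempty ∧ ∑ s ∈ B, wt s = 0 ∧ p B),
        numPos wt B * ∑ 𝔮 ∈ Finset.univ.filter (IsPart wt (S \ B)),
          𝔮.card.factorial * ∏ C ∈ 𝔮, numPos wt C := by
  simp_rw [← smul_eq_mul, ← Finset.sum_const, Finset.smul_sum, smul_eq_mul]
  rw [Finset.sum_sigma', Finset.sum_sigma']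
  refine Finset.sum_bij' (fun x _ => ⟨x.2, x.1.erase x.2⟩) (fun y _ => ⟨insert y.1 y.2, y.1⟩)
    ?_ ?_ ?_ ?_ ?_
  · rintro ⟨𝔭, B⟩ h
    simp only [Finset.mem_sigma, Finset.mem_filter, Finset.mem_univ, true_and,
      Finset.mem_powerset] at h ⊢
    obtain ⟨h, hB, hp⟩ := h
    exact ⟨⟨h.2.1 B hB, h.1 B hB, h.2.2.2 B hB, hp⟩, h.erase hB⟩
  · rintro ⟨B, 𝔮⟩ h
    simp only [Finset.mem_sigma, Finset.mem_filter, Finset.mem_univ, true_and,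
      Finset.mem_powerset] at h ⊢
    obtain ⟨⟨hBS, hB, h0, hp⟩, h⟩ := h
    exact ⟨h.insert hBS hB h0, Finset.mem_insert_self _ _, hp⟩
  · rintro ⟨𝔭, B⟩ h
    simp only [Finset.mem_sigma, Finset.mem_filter] at h
    simp [Finset.insert_erase h.2.1]
  · rintro ⟨B, 𝔮⟩ h
    simp only [Finset.mem_sigma, Finset.mem_filter, Finset.mem_univ, true_and] at h
    simp [Finset.erase_insert (h.2.notMem_of_sdiff h.1.2.1)]
  · rintro ⟨𝔭, B⟩ h
    simp only [Finset.mem_sigma, Finset.mem_filter] at h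
    dsimp only
    rw [Finset.card_erase_of_mem h.2.1, ← Finset.mul_prod_erase 𝔭 _ h.2.1]
    ring

open Classical in
lemma card_nonneg_eq_sum [Fintype α] (wt : α → ℝ) (S : Finset α) (hS : ∑ s ∈ S, wt s = 0) :
    ((orderings S).filter (NonnegList wt)).card =
      ∑ 𝔭 ∈ Finset.univ.filter (IsPart wt S), 𝔭.card.factorial * ∏ B ∈ 𝔭, numPos wt B := by
  induction S using Finset.strongInduction with
  | H S ih =>
  rcases S.eq_empty_or_nonempty with rfl | hne
  · have h1 : (orderings (∅ : Finset α)).filter (NonnegList wt) = {[]} := by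
      ext l
      simp only [Finset.mem_filter, mem_orderings, Finset.mem_singleton, Finset.notMem_empty,
        iff_false]
      constructor
      · rintro ⟨⟨-, h⟩, -⟩
        exact List.eq_nil_iff_forall_not_mem.2 h
      · rintro rfl
        refine ⟨by simp, ?_⟩
        intro u v h
        simp at h
        simp [h.1]
    have h2 : Finset.univ.filter (IsPart wt (∅ : Finset α)) = {∅} := by
      ext 𝔭
      simp only [Finset.mem_filter, Finset.mem_univ, true_and, Finset.mem_singleton]
      constructor
      · rintro ⟨h1, h2, -⟩
        refine Finset.eq_empty_of_forall_notMem fun B hB => ?_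
        exact (h1 B hB).ne_empty (Finset.subset_empty.1 (h2 B hB))
      · rintro rfl
        simp [IsPart]
    simp [h1, h2]
  · have h1 : (orderings S).filter (NonnegList wt) =
        (orderings S).filter (FirstBlock wt fun b => (fun _ => True) b.toFinset) := by
      refine Finset.filter_congr fun l hl => ⟨fun h => ?_, FirstBlock.nonneg⟩
      refine h.exists_firstBlock ?_ ((sum_map_of_mem_orderings hl).trans hS)
      rintro rfl
      obtain ⟨x, hx⟩ := hne
      simpa using ((mem_orderings.1 hl).2 x).2 hx
    refine (congrArg Finset.card h1).trans ((card_filter_firstBlock wt S fun _ => True).trans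
      (Eq.trans ?_ ((sum_isPart_split wt S fun _ => True).symm.trans
        (Finset.sum_congr rfl fun 𝔭 h𝔭 => ?_))))
    swap
    · obtain ⟨x, hx⟩ := hne
      obtain ⟨B, ⟨hB, -⟩, -⟩ := (Finset.mem_filter.1 h𝔭).2.2.2.1 x hx
      rw [Finset.filter_true, ← mul_assoc,
        Nat.mul_factorial_pred (Finset.card_pos.2 ⟨B, hB⟩).ne']
    refine Finset.sum_congr rfl fun B hB => ?_
    simp only [Finset.mem_filter, Finset.mem_powerset] at hB
    obtain ⟨hBS, hBne, h0, -⟩ := hB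
    rw [ih (S \ B) (Finset.sdiff_ssubset hBS hBne)]
    rw [← Finset.sum_sdiff hBS, h0, add_zero] at hS
    exact hS

end

open Classical in
theorem stmt_13 {α : Type*} [Fintype α] (wt : α → ℝ)
    (hwt : ∀ s, wt s ≠ 0) (hsum : ∑ s, wt s = 0) (hcard : 2 ≤ Fintype.card α)
    (hdec : ∃ A : Finset α, A.Nonempty ∧ A ≠ Finset.univ ∧ ∑ s ∈ A, wt s = 0) :
    Nat.factorial (Fintype.card α - 1) =
      ∑ 𝔭 ∈ Finset.univ.filter (IsPart wt Finset.univ),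
        Nat.factorial (𝔭.card - 1) * ∏ B ∈ 𝔭, numPos wt B := by
  obtain ⟨a⟩ : Nonempty α := Fintype.card_pos_iff.1 (by omega)
  have h1 := card_filter_firstBlock wt Finset.univ (a ∈ ·)
  simp only [List.mem_toFinset] at h1
  rw [card_filter_firstBlock_mem (Finset.mem_univ a) hsum, Finset.card_univ] at h1
  rw [h1]
  refine Eq.trans ?_ ((sum_isPart_split wt Finset.univ (a ∈ ·)).symm.trans
    (Finset.sum_congr rfl fun 𝔭 h𝔭 => ?_))
  swap
  · obtain ⟨B, ⟨hB, haB⟩, hu⟩ := (Finset.mem_filter.1 h𝔭).2.2.2.1 a (Finset.mem_univ a)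
    rw [Finset.card_eq_one.2 ⟨B, ?_⟩, one_mul]
    ext C
    simp only [Finset.mem_filter, Finset.mem_singleton]
    refine ⟨hu C, ?_⟩
    rintro rfl
    exact ⟨hB, haB⟩
  refine Finset.sum_congr (by congr) fun B hB => ?_
  simp only [Finset.mem_filter] at hB
  rw [card_nonneg_eq_sum]
  rw [← Finset.sum_sdiff (Finset.subset_univ B), hB.2.2.1, add_zero] at hsum
  exact hsum
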